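/- Let H be a Hopf algebra over k with bijective antipode, R a bialgebra in ᴴᴴYD, and R^op̲ the corresponding bialgebra in the Yetter–Drinfel'd category over H^op (with action h·_op r = S⁻¹(h)·r, multiplication m^op̲(r ⊗ r') = r'r, coproduct Δ^op̲(r) = S⁻¹(r⁽²⁾₍₋₁₎)·r⁽¹⁾ ⊗ r⁽²⁾₍₀₎). Then the map φ : R^op̲ # H^op → (R#H)^op given by φ(r#h) = (1#h)(r#1) (product computed in R#H) is an isomorphism of bialgebras, with inverse φ⁻¹(r#h) = S⁻¹(h₁)·r # h₂. -/

import Mathlib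

open TensorProduct Coalgebra

universe u

variable {k H R : Type u} [Field k] [Ring H] [HopfAlgebra k H]
  [AddCommGroup R] [Module k R]

/-- The left hand side `h ⊗ m ↦ h₁ m₍₋₁₎ ⊗ h₂ · m₍₀₎` of the Yetter–Drinfel'd
compatibility condition. -/
noncomputable def ydLHS (act : H ⊗[k] R →ₗ[k] R) (coact : R →ₗ[k] H ⊗[k] R) :
    H ⊗[k] R →ₗ[k] H ⊗[k] R :=
  TensorProduct.map (LinearMap.mul' k H) act
    ∘ₗ (TensorProduct.tensorTensorTensorComm k H H H R).toLinearMap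
    ∘ₗ TensorProduct.map (Coalgebra.comul : H →ₗ[k] H ⊗[k] H) coact

/-- The right hand side `h ⊗ m ↦ (h₁ · m)₍₋₁₎ h₂ ⊗ (h₁ · m)₍₀₎` of the Yetter–Drinfel'd
compatibility condition. -/
noncomputable def ydRHS (act : H ⊗[k] R →ₗ[k] R) (coact : R →ₗ[k] H ⊗[k] R) :
    H ⊗[k] R →ₗ[k] H ⊗[k] R :=
  TensorProduct.map (LinearMap.mul' k H ∘ₗ (TensorProduct.comm k H H).toLinearMap) LinearMap.id
    ∘ₗ (TensorProduct.assoc k H H R).symm.toLinearMap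
    ∘ₗ TensorProduct.map LinearMap.id (coact ∘ₗ act)
    ∘ₗ (TensorProduct.assoc k H H R).toLinearMap
    ∘ₗ TensorProduct.map (TensorProduct.comm k H H).toLinearMap LinearMap.id
    ∘ₗ TensorProduct.map (Coalgebra.comul : H →ₗ[k] H ⊗[k] H) LinearMap.id

/-- the diagonal action on a tensor product of `H`-modules. -/
noncomputable def actTensor {N : Type u} [AddCommGroup N] [Module k N]
    (actM : H ⊗[k] R →ₗ[k] R) (actN : H ⊗[k] N →ₗ[k] N) :
    H ⊗[k] (R ⊗[k] N) →ₗ[k] R ⊗[k] N :=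
  TensorProduct.map actM actN
    ∘ₗ (TensorProduct.tensorTensorTensorComm k H H R N).toLinearMap
    ∘ₗ TensorProduct.map (Coalgebra.comul : H →ₗ[k] H ⊗[k] H) LinearMap.id

/-- the codiagonal coaction on a tensor product of `H`-comodules. -/
noncomputable def coactTensor {N : Type u} [AddCommGroup N] [Module k N]
    (coactM : R →ₗ[k] H ⊗[k] R) (coactN : N →ₗ[k] H ⊗[k] N) :
    R ⊗[k] N →ₗ[k] H ⊗[k] (R ⊗[k] N) :=
  TensorProduct.map (LinearMap.mul' k H) LinearMap.id
    ∘ₗ (TensorProduct.tensorTensorTensorComm k H R H N).toLinearMap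
    ∘ₗ TensorProduct.map coactM coactN

/-- the braiding `σ(r ⊗ s) = r₍₋₁₎·s ⊗ r₍₀₎` of the Yetter–Drinfel'd category. -/
noncomputable def ydBraiding (coactM : R →ₗ[k] H ⊗[k] R) (actN : H ⊗[k] R →ₗ[k] R) :
    R ⊗[k] R →ₗ[k] R ⊗[k] R :=
  TensorProduct.map actN LinearMap.id
    ∘ₗ (TensorProduct.assoc k H R R).symm.toLinearMap
    ∘ₗ TensorProduct.map LinearMap.id (TensorProduct.comm k R R).toLinearMap
    ∘ₗ (TensorProduct.assoc k H R R).toLinearMap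
    ∘ₗ TensorProduct.map coactM LinearMap.id

/-- the multiplication `(r ⊗ s)(r' ⊗ s') = r(s₍₋₁₎·r') ⊗ s₍₀₎s'` of `R ⊗̲ R`. -/
noncomputable def mulBraided (act : H ⊗[k] R →ₗ[k] R) (coact : R →ₗ[k] H ⊗[k] R)
    (mR : R ⊗[k] R →ₗ[k] R) : (R ⊗[k] R) ⊗[k] (R ⊗[k] R) →ₗ[k] R ⊗[k] R :=
  TensorProduct.map mR mR
    ∘ₗ (TensorProduct.assoc k (R ⊗[k] R) R R).toLinearMap
    ∘ₗ TensorProduct.map (TensorProduct.assoc k R R R).symm.toLinearMap LinearMap.id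
    ∘ₗ TensorProduct.map (TensorProduct.map LinearMap.id (ydBraiding coact act)) LinearMap.id
    ∘ₗ TensorProduct.map (TensorProduct.assoc k R R R).toLinearMap LinearMap.id
    ∘ₗ (TensorProduct.assoc k (R ⊗[k] R) R R).symm.toLinearMap

/-- the smash product multiplication `(r # h)(r' # h') = r(h₁·r') # h₂h'` on `R ⊗ H`. -/
noncomputable def mulSmash (act : H ⊗[k] R →ₗ[k] R) (mR : R ⊗[k] R →ₗ[k] R) :
    (R ⊗[k] H) ⊗[k] (R ⊗[k] H) →ₗ[k] R ⊗[k] H :=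
  TensorProduct.map
      (mR ∘ₗ TensorProduct.map LinearMap.id act ∘ₗ (TensorProduct.assoc k R H R).toLinearMap)
      (LinearMap.mul' k H)
    ∘ₗ (TensorProduct.tensorTensorTensorComm k (R ⊗[k] H) H R H).toLinearMap
    ∘ₗ TensorProduct.map
        ((TensorProduct.assoc k R H H).symm.toLinearMap
          ∘ₗ TensorProduct.map LinearMap.id (Coalgebra.comul : H →ₗ[k] H ⊗[k] H))
        LinearMap.id

/-- the smash coproduct `Δ(r # h) = (r⁽¹⁾ # r⁽²⁾₍₋₁₎h₁) ⊗ (r⁽²⁾₍₀₎ # h₂)` on `R ⊗ H`. -/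
noncomputable def comulSmash (coact : R →ₗ[k] H ⊗[k] R) (ΔR : R →ₗ[k] R ⊗[k] R) :
    R ⊗[k] H →ₗ[k] (R ⊗[k] H) ⊗[k] (R ⊗[k] H) :=
  TensorProduct.map
      (TensorProduct.map LinearMap.id (LinearMap.mul' k H)
        ∘ₗ (TensorProduct.assoc k R H H).toLinearMap)
      LinearMap.id
    ∘ₗ (TensorProduct.tensorTensorTensorComm k (R ⊗[k] H) R H H).toLinearMap
    ∘ₗ TensorProduct.map
        ((TensorProduct.assoc k R H R).symm.toLinearMap
          ∘ₗ TensorProduct.map LinearMap.id coact ∘ₗ ΔR)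
        (Coalgebra.comul : H →ₗ[k] H ⊗[k] H)

/-- the counit `ε(r # h) = ε_R(r) ε_H(h)` of `R ⊗ H`. -/
noncomputable def counitSmash (εR : R →ₗ[k] k) : R ⊗[k] H →ₗ[k] k :=
  LinearMap.mul' k k ∘ₗ TensorProduct.map εR (Coalgebra.counit : H →ₗ[k] k)

/-- A bialgebra `R` in the braided category of Yetter–Drinfel'd modules over `H`:
`R` is a Yetter–Drinfel'd module, a unital associative algebra and a counital coassociative
coalgebra whose structure maps are morphisms in the category, and whose coproduct and counit
are algebra maps with respect to the braided algebra structure of `R ⊗̲ R`. -/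
structure YDBialgebra (k H R : Type u) [Field k] [Ring H] [HopfAlgebra k H]
    [AddCommGroup R] [Module k R] where
  act : H ⊗[k] R →ₗ[k] R
  coact : R →ₗ[k] H ⊗[k] R
  mR : R ⊗[k] R →ₗ[k] R
  oneR : R
  ΔR : R →ₗ[k] R ⊗[k] R
  εR : R →ₗ[k] k
  act_one : ∀ r : R, act ((1 : H) ⊗ₜ r) = r
  act_mul : ∀ (g h : H) (r : R), act ((g * h) ⊗ₜ r) = act (g ⊗ₜ act (h ⊗ₜ r))
  comod_coassoc : TensorProduct.map (Coalgebra.comul : H →ₗ[k] H ⊗[k] H) LinearMap.id ∘ₗ coact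
    = (TensorProduct.assoc k H H R).symm.toLinearMap
        ∘ₗ TensorProduct.map LinearMap.id coact ∘ₗ coact
  comod_counit : (TensorProduct.lid k R).toLinearMap
      ∘ₗ TensorProduct.map (Coalgebra.counit : H →ₗ[k] k) LinearMap.id ∘ₗ coact
    = LinearMap.id
  yd : ydLHS act coact = ydRHS act coact
  mul_assoc : mR ∘ₗ TensorProduct.map mR LinearMap.id
    = mR ∘ₗ TensorProduct.map LinearMap.id mR ∘ₗ (TensorProduct.assoc k R R R).toLinearMap
  one_mul : ∀ r : R, mR (oneR ⊗ₜ r) = r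
  mul_one : ∀ r : R, mR (r ⊗ₜ oneR) = r
  mul_lin : mR ∘ₗ actTensor act act = act ∘ₗ TensorProduct.map LinearMap.id mR
  mul_colin : coact ∘ₗ mR = TensorProduct.map LinearMap.id mR ∘ₗ coactTensor coact coact
  one_lin : ∀ h : H, act (h ⊗ₜ oneR) = (Coalgebra.counit h : k) • oneR
  one_colin : coact oneR = (1 : H) ⊗ₜ oneR
  Δ_coassoc : TensorProduct.map ΔR LinearMap.id ∘ₗ ΔR
    = (TensorProduct.assoc k R R R).symm.toLinearMap ∘ₗ TensorProduct.map LinearMap.id ΔR ∘ₗ ΔR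
  Δ_counit₁ : (TensorProduct.lid k R).toLinearMap
      ∘ₗ TensorProduct.map εR LinearMap.id ∘ₗ ΔR = LinearMap.id
  Δ_counit₂ : (TensorProduct.rid k R).toLinearMap
      ∘ₗ TensorProduct.map LinearMap.id εR ∘ₗ ΔR = LinearMap.id
  Δ_lin : ΔR ∘ₗ act = actTensor act act ∘ₗ TensorProduct.map LinearMap.id ΔR
  Δ_colin : coactTensor coact coact ∘ₗ ΔR = TensorProduct.map LinearMap.id ΔR ∘ₗ coact
  ε_lin : εR ∘ₗ act
    = LinearMap.mul' k k ∘ₗ TensorProduct.map (Coalgebra.counit : H →ₗ[k] k) εR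
  ε_colin : (TensorProduct.rid k H).toLinearMap
      ∘ₗ TensorProduct.map LinearMap.id εR ∘ₗ coact = Algebra.linearMap k H ∘ₗ εR
  Δ_mul : ΔR ∘ₗ mR = mulBraided act coact mR ∘ₗ TensorProduct.map ΔR ΔR
  ε_mul : εR ∘ₗ mR = LinearMap.mul' k k ∘ₗ TensorProduct.map εR εR
  Δ_one : ΔR oneR = oneR ⊗ₜ oneR
  ε_one : εR oneR = 1

/-- the smash multiplication on `R ⊗ H` with an arbitrary multiplication `mH` on `H`
(used for `H^op`): `(r # h)(r' # h') = r(h₁·r') # mH(h₂ ⊗ h')`. -/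
noncomputable def mulSmashG (act : H ⊗[k] R →ₗ[k] R) (mR : R ⊗[k] R →ₗ[k] R)
    (mH : H ⊗[k] H →ₗ[k] H) : (R ⊗[k] H) ⊗[k] (R ⊗[k] H) →ₗ[k] R ⊗[k] H :=
  TensorProduct.map
      (mR ∘ₗ TensorProduct.map LinearMap.id act ∘ₗ (TensorProduct.assoc k R H R).toLinearMap)
      mH
    ∘ₗ (TensorProduct.tensorTensorTensorComm k (R ⊗[k] H) H R H).toLinearMap
    ∘ₗ TensorProduct.map
        ((TensorProduct.assoc k R H H).symm.toLinearMap
          ∘ₗ TensorProduct.map LinearMap.id (Coalgebra.comul : H →ₗ[k] H ⊗[k] H))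
        LinearMap.id

/-- the smash coproduct on `R ⊗ H` with an arbitrary multiplication `mH` on `H`:
`Δ(r # h) = (r⁽¹⁾ # mH(r⁽²⁾₍₋₁₎ ⊗ h₁)) ⊗ (r⁽²⁾₍₀₎ # h₂)`. -/
noncomputable def comulSmashG (coact : R →ₗ[k] H ⊗[k] R) (ΔR : R →ₗ[k] R ⊗[k] R)
    (mH : H ⊗[k] H →ₗ[k] H) : R ⊗[k] H →ₗ[k] (R ⊗[k] H) ⊗[k] (R ⊗[k] H) :=
  TensorProduct.map
      (TensorProduct.map LinearMap.id mH ∘ₗ (TensorProduct.assoc k R H H).toLinearMap)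
      LinearMap.id
    ∘ₗ (TensorProduct.tensorTensorTensorComm k (R ⊗[k] H) R H H).toLinearMap
    ∘ₗ TensorProduct.map
        ((TensorProduct.assoc k R H R).symm.toLinearMap
          ∘ₗ TensorProduct.map LinearMap.id coact ∘ₗ ΔR)
        (Coalgebra.comul : H →ₗ[k] H ⊗[k] H)

/-- the inverse braiding `x ⊗ y ↦ S⁻¹(y₍₋₁₎)·x ⊗ y₍₀₎` on `R ⊗ R`. -/
noncomputable def thetaMap (Sinv : H →ₗ[k] H) (act : H ⊗[k] R →ₗ[k] R)
    (coact : R →ₗ[k] H ⊗[k] R) : R ⊗[k] R →ₗ[k] R ⊗[k] R :=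
  TensorProduct.map (act ∘ₗ TensorProduct.map Sinv LinearMap.id) LinearMap.id
    ∘ₗ TensorProduct.map (TensorProduct.comm k R H).toLinearMap LinearMap.id
    ∘ₗ (TensorProduct.assoc k R H R).symm.toLinearMap
    ∘ₗ TensorProduct.map LinearMap.id coact

namespace YDBialgebra

variable (B : YDBialgebra k H R)

/-- `h ↦ h · r`. -/
noncomputable def aa (r : R) : H →ₗ[k] R := (TensorProduct.curry B.act).flip r

/-- `s ↦ r s`. -/
noncomputable def ml (r : R) : R →ₗ[k] R := TensorProduct.curry B.mR r

theorem aa_apply (r : R) (h : H) : B.aa r h = B.act (h ⊗ₜ r) := rfl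
theorem ml_apply (r s : R) : B.ml r s = B.mR (r ⊗ₜ s) := rfl

theorem mulSmash_tmul (r r' : R) (h h' : H) :
    mulSmash B.act B.mR ((r ⊗ₜ h) ⊗ₜ (r' ⊗ₜ h')) =
      TensorProduct.map (B.ml r ∘ₗ B.aa r') (LinearMap.mulRight k h') (comul (R := k) h) := by
  simp only [mulSmash, LinearMap.comp_apply, TensorProduct.map_tmul, LinearMap.id_apply]
  generalize (comul (R := k) h : H ⊗[k] H) = x
  induction x with
  | zero => simp
  | tmul a b => simp [aa_apply, ml_apply]
  | add x y hx hy => simp only [tmul_add, add_tmul, map_add, hx, hy]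

theorem act_mR (h : H) (a b : R) : B.act (h ⊗ₜ B.mR (a ⊗ₜ b)) =
    B.mR (TensorProduct.map (B.aa a) (B.aa b) (comul (R := k) h)) := by
  have := LinearMap.congr_fun B.mul_lin (h ⊗ₜ (a ⊗ₜ b))
  simp only [actTensor, LinearMap.comp_apply, TensorProduct.map_tmul, LinearMap.id_apply] at this
  rw [← this]
  congr 1
  generalize (comul (R := k) h : H ⊗[k] H) = x
  induction x with
  | zero => simp
  | tmul a b => simp [aa_apply]
  | add x y hx hy => simp only [add_tmul, map_add, hx, hy]

theorem mR_assoc (a b c : R) : B.mR (B.mR (a ⊗ₜ b) ⊗ₜ c) = B.mR (a ⊗ₜ B.mR (b ⊗ₜ c)) := by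
  simpa using LinearMap.congr_fun B.mul_assoc ((a ⊗ₜ b) ⊗ₜ c)

theorem smash_assoc (x y z : R ⊗[k] H) :
    mulSmash B.act B.mR (mulSmash B.act B.mR (x ⊗ₜ y) ⊗ₜ z) =
    mulSmash B.act B.mR (x ⊗ₜ mulSmash B.act B.mR (y ⊗ₜ z)) := by
  induction x with
  | zero => simp
  | add x y hx hy => simp only [add_tmul, map_add, hx, hy]
  | tmul r h =>
  induction y with
  | zero => simp
  | add x y hx hy => simp only [add_tmul, tmul_add, map_add, hx, hy]
  | tmul r' h' =>
  induction z with
  | zero => simp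
  | add x y hx hy => simp only [tmul_add, map_add, hx, hy]
  | tmul r'' h'' =>
  rw [mulSmash_tmul, mulSmash_tmul]
  have h1 : ∀ x : H ⊗[k] H,
      mulSmash B.act B.mR (TensorProduct.map (B.ml r ∘ₗ B.aa r') (LinearMap.mulRight k h') x
        ⊗ₜ[k] (r'' ⊗ₜ[k] h'')) =
      TensorProduct.map (B.ml r) LinearMap.id (TensorProduct.map B.mR LinearMap.id
        ((TensorProduct.assoc k R R H).symm (TensorProduct.map (B.aa r')
          (TensorProduct.map (B.aa r'') (LinearMap.mulRight k h'') ∘ₗ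
            LinearMap.mulRight k (comul (R := k) h') ∘ₗ comul) x))) := by
    intro x
    induction x with
    | zero => simp
    | add x y hx hy => simp only [add_tmul, map_add, hx, hy]
    | tmul a b =>
      simp only [map_tmul, mulSmash_tmul, LinearMap.comp_apply, LinearMap.mulRight_apply,
        Bialgebra.comul_mul]
      generalize (comul (R := k) b * comul (R := k) h' : H ⊗[k] H) = y
      induction y with
      | zero => simp
      | add x y hx hy => simp only [tmul_add, map_add, hx, hy]
      | tmul c d => simp [aa_apply, ml_apply, mR_assoc]
  rw [h1]
  generalize (comul (R := k) h' : H ⊗[k] H) = y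
  induction y with
  | zero => simp [LinearMap.mulRight_zero_eq_zero]
  | add x y hx hy =>
    simp only [tmul_add, map_add, ← hx, ← hy]
    rw [← map_add, ← map_add, ← map_add, ← LinearMap.add_apply, ← TensorProduct.map_add_right,
      ← LinearMap.comp_add, ← LinearMap.add_comp]
    congr!
    ext; simp [mul_add]
  | tmul p q =>
    simp only [map_tmul, mulSmash_tmul, LinearMap.mulRight_apply]
    have h2 : ∀ x : H ⊗[k] H, TensorProduct.map (B.ml r ∘ₗ B.aa ((B.ml r' ∘ₗ B.aa r'') p))
        (LinearMap.mulRight k (q * h'')) x =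
        TensorProduct.map (B.ml r ∘ₗ B.mR ∘ₗ TensorProduct.map (B.aa r')
          (B.aa (B.aa r'' p))) (LinearMap.mulRight k (q * h''))
          (TensorProduct.map comul LinearMap.id x) := by
      intro x
      induction x with
      | zero => simp
      | add x y hx hy => simp only [map_add, hx, hy]
      | tmul a b => simp [aa_apply, ml_apply, act_mR]
    rw [h2]
    have := Coalgebra.coassoc_symm_apply (R := k) h
    simp only [LinearMap.rTensor, LinearMap.lTensor] at this
    rw [← this]
    generalize (comul (R := k) h : H ⊗[k] H) = x
    induction x with
    | zero => simp
    | add x y hx hy => simp only [map_add, hx, hy]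
    | tmul a b =>
      simp only [map_tmul, LinearMap.comp_apply, LinearMap.id_apply]
      generalize (comul (R := k) b : H ⊗[k] H) = y
      induction y with
      | zero => simp
      | add x y hx hy => simp only [tmul_add, map_add, hx, hy]
      | tmul c d => simp [aa_apply, ml_apply, act_mul, _root_.mul_assoc]

theorem tmul_one_mul (r s : R) (h : H) :
    mulSmash B.act B.mR ((r ⊗ₜ 1) ⊗ₜ (s ⊗ₜ h)) = B.mR (r ⊗ₜ s) ⊗ₜ h := by
  simp [mulSmash_tmul, Algebra.TensorProduct.one_def, aa_apply, ml_apply, act_one]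

theorem mul_one_tmul (r : R) (g h : H) :
    mulSmash B.act B.mR ((r ⊗ₜ g) ⊗ₜ (B.oneR ⊗ₜ h)) = r ⊗ₜ (g * h) := by
  rw [mulSmash_tmul]
  have h2 : ∀ x : H ⊗[k] H, TensorProduct.map (B.ml r ∘ₗ B.aa B.oneR)
        (LinearMap.mulRight k h) x = TensorProduct.map (LinearMap.toSpanSingleton k R r)
        (LinearMap.mulRight k h) (counit.rTensor H x) := by
    intro x
    induction x with
    | zero => simp
    | add x y hx hy => simp only [map_add, hx, hy]
    | tmul a b => simp [aa_apply, ml_apply, one_lin, mul_one]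
  rw [h2, Coalgebra.rTensor_counit_comul]
  simp

/-- the map `φ`. -/
noncomputable def phi : R ⊗[k] H →ₗ[k] R ⊗[k] H :=
  mulSmash B.act B.mR
        ∘ₗ TensorProduct.map (TensorProduct.mk k R H B.oneR)
            ((TensorProduct.mk k R H).flip (1 : H))
        ∘ₗ (TensorProduct.comm k R H).toLinearMap

theorem phi_tmul (r : R) (h : H) :
    B.phi (r ⊗ₜ h) = mulSmash B.act B.mR ((B.oneR ⊗ₜ h) ⊗ₜ (r ⊗ₜ 1)) := rfl

theorem one_ml : B.ml B.oneR = LinearMap.id := by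
  ext; simp [ml_apply, one_mul]

theorem phi_tmul' (r : R) (h : H) :
    B.phi (r ⊗ₜ h) = (B.aa r).rTensor H (comul (R := k) h) := by
  rw [phi_tmul, mulSmash_tmul, one_ml]
  simp [LinearMap.rTensor]

/-- the map `ψ`. -/
noncomputable def psi (Sinv : H →ₗ[k] H) : R ⊗[k] H →ₗ[k] R ⊗[k] H :=
  TensorProduct.map
          (B.act ∘ₗ TensorProduct.map Sinv LinearMap.id ∘ₗ (TensorProduct.comm k R H).toLinearMap)
          LinearMap.id
        ∘ₗ (TensorProduct.assoc k R H H).symm.toLinearMap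
        ∘ₗ TensorProduct.map LinearMap.id (Coalgebra.comul : H →ₗ[k] H ⊗[k] H)

theorem psi_tmul (Sinv : H →ₗ[k] H) (r : R) (h : H) :
    B.psi Sinv (r ⊗ₜ h) = (B.aa r ∘ₗ Sinv).rTensor H (comul (R := k) h) := by
  simp only [psi, LinearMap.comp_apply, TensorProduct.map_tmul, LinearMap.id_apply]
  generalize (comul (R := k) h : H ⊗[k] H) = x
  induction x with
  | zero => simp
  | tmul a b => simp [aa_apply]
  | add x y hx hy => simp only [tmul_add, map_add, hx, hy]

section inverse

variable (Sinv : H →ₗ[k] H)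

theorem sinv_left
    (hS₁ : HopfAlgebra.antipode (R := k) ∘ₗ Sinv = LinearMap.id)
    (hS₂ : Sinv ∘ₗ HopfAlgebra.antipode (R := k) = LinearMap.id) (h : H) : LinearMap.mul' k H (TensorProduct.map LinearMap.id Sinv
    (TensorProduct.comm k H H (comul (R := k) h))) = algebraMap k H (counit (R := k) h) := by
  have hinj : Function.Injective (HopfAlgebra.antipode k (A := H)) := fun a b hab => by
    have := congrArg Sinv hab
    simpa [← LinearMap.comp_apply, hS₂] using this
  have h1 : ∀ g, HopfAlgebra.antipode k (Sinv g) = g := fun g => LinearMap.congr_fun hS₁ g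
  apply hinj
  have : ∀ x : H ⊗[k] H, HopfAlgebra.antipode k (LinearMap.mul' k H
      (TensorProduct.map LinearMap.id Sinv (TensorProduct.comm k H H x))) =
      LinearMap.mul' k H ((HopfAlgebra.antipode k).lTensor H x) := by
    intro x
    induction x with
    | zero => simp
    | add x y hx hy => simp only [map_add, hx, hy]
    | tmul a b => simp [HopfAlgebra.antipode_mul_antidistrib, h1]
  rw [this, HopfAlgebra.mul_antipode_lTensor_comul_apply]
  simp [Algebra.algebraMap_eq_smul_one]

theorem sinv_right
    (hS₁ : HopfAlgebra.antipode (R := k) ∘ₗ Sinv = LinearMap.id)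
    (hS₂ : Sinv ∘ₗ HopfAlgebra.antipode (R := k) = LinearMap.id) (h : H) : LinearMap.mul' k H (TensorProduct.map Sinv LinearMap.id
    (TensorProduct.comm k H H (comul (R := k) h))) = algebraMap k H (counit (R := k) h) := by
  have hinj : Function.Injective (HopfAlgebra.antipode k (A := H)) := fun a b hab => by
    have := congrArg Sinv hab
    simpa [← LinearMap.comp_apply, hS₂] using this
  have h1 : ∀ g, HopfAlgebra.antipode k (Sinv g) = g := fun g => LinearMap.congr_fun hS₁ g
  apply hinj
  have : ∀ x : H ⊗[k] H, HopfAlgebra.antipode k (LinearMap.mul' k H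
      (TensorProduct.map Sinv LinearMap.id (TensorProduct.comm k H H x))) =
      LinearMap.mul' k H ((HopfAlgebra.antipode k).rTensor H x) := by
    intro x
    induction x with
    | zero => simp
    | add x y hx hy => simp only [map_add, hx, hy]
    | tmul a b => simp [HopfAlgebra.antipode_mul_antidistrib, h1]
  rw [this, HopfAlgebra.mul_antipode_rTensor_comul_apply]
  simp [Algebra.algebraMap_eq_smul_one]

theorem gen_inv (f g : H →ₗ[k] H) (r : R) (h : H)
    (hfg : ∀ h, LinearMap.mul' k H (TensorProduct.map f g
      (TensorProduct.comm k H H (comul (R := k) h))) = algebraMap k H (counit (R := k) h))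
    (F : R ⊗[k] H →ₗ[k] R ⊗[k] H)
    (hF : ∀ r h, F (r ⊗ₜ h) = (B.aa r ∘ₗ f).rTensor H (comul (R := k) h)) :
    F ((B.aa r ∘ₗ g).rTensor H (comul (R := k) h)) = r ⊗ₜ h := by
  have h1 : ∀ x : H ⊗[k] H, F ((B.aa r ∘ₗ g).rTensor H x) =
      (B.aa r ∘ₗ LinearMap.mul' k H ∘ₗ TensorProduct.map f g ∘ₗ
        (TensorProduct.comm k H H).toLinearMap).rTensor H
        ((TensorProduct.assoc k H H H).symm (comul.lTensor H x)) := by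
    intro x
    induction x with
    | zero => simp
    | add x y hx hy => simp only [map_add, hx, hy]
    | tmul a b =>
      simp only [LinearMap.rTensor_tmul, LinearMap.lTensor_tmul, hF]
      generalize (comul (R := k) b : H ⊗[k] H) = y
      induction y with
      | zero => simp
      | add x y hx hy => simp only [tmul_add, map_add, hx, hy]
      | tmul c d => simp [aa_apply, act_mul]
  rw [h1, Coalgebra.coassoc_symm_apply]
  have h2 : ∀ x : H ⊗[k] H, (B.aa r ∘ₗ LinearMap.mul' k H ∘ₗ TensorProduct.map f g ∘ₗ
        (TensorProduct.comm k H H).toLinearMap).rTensor H (comul.rTensor H x) =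
      (LinearMap.toSpanSingleton k R r).rTensor H (counit.rTensor H x) := by
    intro x
    induction x with
    | zero => simp
    | add x y hx hy => simp only [map_add, hx, hy]
    | tmul a b =>
      simp only [LinearMap.rTensor_tmul, LinearMap.comp_apply, LinearEquiv.coe_coe, hfg]
      simp [Algebra.algebraMap_eq_smul_one, aa_apply, act_one]
  rw [h2, Coalgebra.rTensor_counit_comul]
  simp

theorem phi_psi
    (hS₁ : HopfAlgebra.antipode (R := k) ∘ₗ Sinv = LinearMap.id)
    (hS₂ : Sinv ∘ₗ HopfAlgebra.antipode (R := k) = LinearMap.id) (r : R) (h : H) : B.phi (B.psi Sinv (r ⊗ₜ h)) = r ⊗ₜ h := by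
  rw [psi_tmul]
  exact B.gen_inv LinearMap.id Sinv r h (sinv_left Sinv hS₁ hS₂) B.phi (by simp [phi_tmul'])

theorem psi_phi
    (hS₁ : HopfAlgebra.antipode (R := k) ∘ₗ Sinv = LinearMap.id)
    (hS₂ : Sinv ∘ₗ HopfAlgebra.antipode (R := k) = LinearMap.id) (r : R) (h : H) : B.psi Sinv (B.phi (r ⊗ₜ h)) = r ⊗ₜ h := by
  rw [phi_tmul']
  exact B.gen_inv Sinv LinearMap.id r h (sinv_right Sinv hS₁ hS₂) (B.psi Sinv)
    (by simp [psi_tmul])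

theorem phi_mul
    (hS₁ : HopfAlgebra.antipode (R := k) ∘ₗ Sinv = LinearMap.id)
    (hS₂ : Sinv ∘ₗ HopfAlgebra.antipode (R := k) = LinearMap.id) (r r' : R) (h h' : H) :
    B.phi (mulSmashG (B.act ∘ₗ TensorProduct.map Sinv LinearMap.id)
          (B.mR ∘ₗ (TensorProduct.comm k R R).toLinearMap)
          (LinearMap.mul' k H ∘ₗ (TensorProduct.comm k H H).toLinearMap)
          ((r ⊗ₜ h) ⊗ₜ (r' ⊗ₜ h'))) =
    mulSmash B.act B.mR (B.phi (r' ⊗ₜ h') ⊗ₜ B.phi (r ⊗ₜ h)) := by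
  have h1 : B.phi (mulSmashG (B.act ∘ₗ TensorProduct.map Sinv LinearMap.id)
          (B.mR ∘ₗ (TensorProduct.comm k R R).toLinearMap)
          (LinearMap.mul' k H ∘ₗ (TensorProduct.comm k H H).toLinearMap)
          ((r ⊗ₜ h) ⊗ₜ (r' ⊗ₜ h'))) =
      mulSmash B.act B.mR ((B.oneR ⊗ₜ h') ⊗ₜ mulSmash B.act B.mR
        (B.phi (B.psi Sinv (r' ⊗ₜ h)) ⊗ₜ (r ⊗ₜ 1))) := by
    simp only [psi_tmul, mulSmashG, LinearMap.comp_apply, TensorProduct.map_tmul,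
      LinearMap.id_apply]
    generalize (comul (R := k) h : H ⊗[k] H) = x
    induction x with
    | zero => simp
    | add x y hx hy => simp only [tmul_add, add_tmul, map_add, hx, hy]
    | tmul a b =>
      simp only [LinearEquiv.coe_coe, assoc_symm_tmul, assoc_tmul, tensorTensorTensorComm_tmul,
        map_tmul, LinearMap.comp_apply, LinearMap.id_apply, comm_tmul, LinearMap.mul'_apply,
        LinearMap.rTensor_tmul, phi_tmul, smash_assoc, tmul_one_mul, aa_apply]
      rw [← mul_one_tmul, smash_assoc]
  rw [h1, B.phi_psi Sinv hS₁ hS₂, phi_tmul, phi_tmul, smash_assoc,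
    ← B.smash_assoc (r' ⊗ₜ 1), tmul_one_mul, mul_one]

/-- the smash coproduct without the coproduct of `R`. -/
noncomputable def Gm (coact : R →ₗ[k] H ⊗[k] R) (mH : H ⊗[k] H →ₗ[k] H) :
    (R ⊗[k] R) ⊗[k] H →ₗ[k] (R ⊗[k] H) ⊗[k] (R ⊗[k] H) :=
  TensorProduct.map
      (TensorProduct.map LinearMap.id mH ∘ₗ (TensorProduct.assoc k R H H).toLinearMap)
      LinearMap.id
    ∘ₗ (TensorProduct.tensorTensorTensorComm k (R ⊗[k] H) R H H).toLinearMap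
    ∘ₗ TensorProduct.map
        ((TensorProduct.assoc k R H R).symm.toLinearMap
          ∘ₗ TensorProduct.map LinearMap.id coact)
        (Coalgebra.comul : H →ₗ[k] H ⊗[k] H)

/-- `(g ⊗ t) ⊗ (p ⊗ q) ↦ (s ⊗ gp) ⊗ (t ⊗ q)` -/
noncomputable def Em (s : R) (mH : H ⊗[k] H →ₗ[k] H) :
    (H ⊗[k] R) ⊗[k] (H ⊗[k] H) →ₗ[k] (R ⊗[k] H) ⊗[k] (R ⊗[k] H) :=
  TensorProduct.map (TensorProduct.mk k R H s ∘ₗ mH) LinearMap.id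
    ∘ₗ (TensorProduct.tensorTensorTensorComm k H R H H).toLinearMap

theorem Gm_tmul (coact : R →ₗ[k] H ⊗[k] R) (mH : H ⊗[k] H →ₗ[k] H) (s t : R) (h : H) :
    Gm coact mH ((s ⊗ₜ t) ⊗ₜ h) = Em s mH (coact t ⊗ₜ comul (R := k) h) := by
  simp only [Gm, Em, LinearMap.comp_apply, map_tmul, LinearMap.id_apply]
  generalize coact t = z
  generalize (comul (R := k) h : H ⊗[k] H) = y
  induction z with
  | zero => simp
  | add x y hx hy => simp only [tmul_add, add_tmul, map_add, hx, hy]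
  | tmul a b =>
  induction y with
  | zero => simp
  | add x y hx hy => simp only [tmul_add, map_add, hx, hy]
  | tmul c d => simp

/-- `(w ⊗ t) ⊗ (p ⊗ q) ↦ (1 # p)(s # w) ⊗ φ(t # q)` -/
noncomputable def Um (s : R) :
    (H ⊗[k] R) ⊗[k] (H ⊗[k] H) →ₗ[k] (R ⊗[k] H) ⊗[k] (R ⊗[k] H) :=
  TensorProduct.map (mulSmash B.act B.mR ∘ₗ (TensorProduct.comm k _ _).toLinearMap ∘ₗ
      TensorProduct.map (TensorProduct.mk k R H s) (TensorProduct.mk k R H B.oneR)) B.phi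
    ∘ₗ (TensorProduct.tensorTensorTensorComm k H R H H).toLinearMap

/-- `((g ⊗ f) ⊗ t) ⊗ (p ⊗ q) ↦ (1 # p)φ(S⁻¹(g)s # f) ⊗ φ(t # q)` -/
noncomputable def Wm (s : R) :
    ((H ⊗[k] H) ⊗[k] R) ⊗[k] (H ⊗[k] H) →ₗ[k] (R ⊗[k] H) ⊗[k] (R ⊗[k] H) :=
  TensorProduct.map (mulSmash B.act B.mR ∘ₗ (TensorProduct.comm k _ _).toLinearMap ∘ₗ
      TensorProduct.map (B.phi ∘ₗ (B.aa s ∘ₗ Sinv).rTensor H)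
        (TensorProduct.mk k R H B.oneR)) B.phi
    ∘ₗ (TensorProduct.tensorTensorTensorComm k (H ⊗[k] H) R H H).toLinearMap

theorem theta_tmul (s t : R) : thetaMap Sinv B.act B.coact (s ⊗ₜ t) =
    TensorProduct.map (B.aa s ∘ₗ Sinv) LinearMap.id (B.coact t) := by
  simp only [thetaMap, LinearMap.comp_apply, map_tmul, LinearMap.id_apply]
  generalize B.coact t = z
  induction z with
  | zero => simp
  | add x y hx hy => simp only [tmul_add, map_add, hx, hy]
  | tmul a b => simp [aa_apply]

theorem rhs_eq
    (hS₁ : HopfAlgebra.antipode (R := k) ∘ₗ Sinv = LinearMap.id)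
    (hS₂ : Sinv ∘ₗ HopfAlgebra.antipode (R := k) = LinearMap.id) (s t : R) (h : H) :
    TensorProduct.map B.phi B.phi (Gm B.coact
      (LinearMap.mul' k H ∘ₗ (TensorProduct.comm k H H).toLinearMap)
      (thetaMap Sinv B.act B.coact (s ⊗ₜ t) ⊗ₜ h)) =
    B.Um s (B.coact t ⊗ₜ comul (R := k) h) := by
  rw [theta_tmul]
  have h1 : ∀ z : H ⊗[k] R, TensorProduct.map B.phi B.phi (Gm B.coact
      (LinearMap.mul' k H ∘ₗ (TensorProduct.comm k H H).toLinearMap)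
      (TensorProduct.map (B.aa s ∘ₗ Sinv) LinearMap.id z ⊗ₜ h)) =
      B.Wm Sinv s ((TensorProduct.assoc k H H R).symm (TensorProduct.map LinearMap.id B.coact z)
        ⊗ₜ comul (R := k) h) := by
    intro z
    induction z with
    | zero => simp
    | add x y hx hy => simp only [add_tmul, map_add, hx, hy]
    | tmul g t =>
      simp only [map_tmul, LinearMap.id_apply, Gm_tmul]
      generalize B.coact t = z
      generalize (comul (R := k) h : H ⊗[k] H) = y
      induction z with
      | zero => simp
      | add x y hx hy => simp only [tmul_add, add_tmul, map_add, hx, hy]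
      | tmul a b =>
      induction y with
      | zero => simp
      | add x y hx hy => simp only [tmul_add, map_add, hx, hy]
      | tmul c d =>
        simp only [Em, Wm, LinearEquiv.coe_coe, assoc_symm_tmul, tensorTensorTensorComm_tmul,
          map_tmul, LinearMap.comp_apply, LinearMap.id_apply, comm_tmul, LinearMap.mul'_apply,
          LinearMap.rTensor_tmul, mk_apply]
        rw [B.phi_tmul _ (c * a), ← mul_one_tmul, smash_assoc, ← phi_tmul]
  have h3 := LinearMap.congr_fun B.comod_coassoc t
  simp only [LinearMap.comp_apply, LinearEquiv.coe_coe] at h3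
  rw [h1, ← h3]
  generalize B.coact t = z
  generalize (comul (R := k) h : H ⊗[k] H) = y
  induction z with
  | zero => simp
  | add x y hx hy => simp only [tmul_add, add_tmul, map_add, hx, hy]
  | tmul a b =>
  induction y with
  | zero => simp
  | add x y hx hy => simp only [tmul_add, map_add, hx, hy]
  | tmul c d =>
    simp only [Wm, Um, LinearEquiv.coe_coe, tensorTensorTensorComm_tmul,
          map_tmul, LinearMap.comp_apply, LinearMap.id_apply, comm_tmul, mk_apply]
    rw [← psi_tmul, B.phi_psi Sinv hS₁ hS₂]

end inverse

/-- `z ↦ (g ↦ g₁ z₋₁ ⊗ g₂ · z₀)` -/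
noncomputable def Jm : (H ⊗[k] R) →ₗ[k] (H →ₗ[k] H ⊗[k] R) :=
  (TensorProduct.curry (TensorProduct.map (LinearMap.mul' k H) B.act
    ∘ₗ (TensorProduct.tensorTensorTensorComm k H H H R).toLinearMap
    ∘ₗ TensorProduct.map (Coalgebra.comul : H →ₗ[k] H ⊗[k] H) LinearMap.id)).flip

theorem Jm_coact (t : R) (g : H) : B.Jm (B.coact t) g = ydLHS B.act B.coact (g ⊗ₜ t) := rfl

theorem Jm_tmul (w g : H) (t : R) : B.Jm (w ⊗ₜ t) g =
    TensorProduct.map (LinearMap.mulRight k w) (B.aa t) (comul (R := k) g) := by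
  simp only [Jm, LinearMap.flip_apply, curry_apply, LinearMap.comp_apply, map_tmul,
    LinearMap.id_apply]
  generalize (comul (R := k) g : H ⊗[k] H) = x
  induction x with
  | zero => simp
  | tmul a b => simp [aa_apply]
  | add x y hx hy => simp only [add_tmul, map_add, hx, hy]

/-- `s ⊗ ((w ⊗ t) ⊗ q) ↦ (s ⊗ w) ⊗ (t ⊗ q)` -/
noncomputable def Yt (k H R : Type u) [Field k] [Ring H] [HopfAlgebra k H]
    [AddCommGroup R] [Module k R] {A B : Type u} [AddCommGroup A] [Module k A]
    [AddCommGroup B] [Module k B] :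
    A ⊗[k] ((H ⊗[k] R) ⊗[k] B) →ₗ[k] (A ⊗[k] H) ⊗[k] (R ⊗[k] B) :=
  (TensorProduct.assoc k A H (R ⊗[k] B)).symm.toLinearMap ∘ₗ
    TensorProduct.map LinearMap.id (TensorProduct.assoc k H R B).toLinearMap

theorem L1 (s t : R) (b : H) :
    Gm B.coact (LinearMap.mul' k H)
      (TensorProduct.map (TensorProduct.mk k R R s ∘ₗ B.aa t) LinearMap.id (comul (R := k) b)) =
    Yt k H R (s ⊗ₜ TensorProduct.map (B.Jm (B.coact t)) LinearMap.id (comul (R := k) b)) := by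
  have h1 : ∀ x : H ⊗[k] H, Gm B.coact (LinearMap.mul' k H)
      (TensorProduct.map (TensorProduct.mk k R R s ∘ₗ B.aa t) LinearMap.id x) =
      TensorProduct.map (TensorProduct.mk k R H s ∘ₗ LinearMap.mul' k H) LinearMap.id
        (TensorProduct.tensorTensorTensorComm k H R H H
        (TensorProduct.map (B.coact ∘ₗ B.aa t) LinearMap.id
          (comul.lTensor H x))) := by
    intro x
    induction x with
    | zero => simp
    | add x y hx hy => simp only [map_add, hx, hy]
    | tmul a b => simp [Gm_tmul, Em]
  have h2 : ∀ x : H ⊗[k] H, Yt k H R (s ⊗ₜ TensorProduct.map (B.Jm (B.coact t)) LinearMap.id x) =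
      TensorProduct.map (TensorProduct.mk k R H s ∘ₗ LinearMap.mul' k H) LinearMap.id
        (TensorProduct.tensorTensorTensorComm k H R H H
        (TensorProduct.map (B.coact ∘ₗ B.aa t) LinearMap.id
          (TensorProduct.assoc k H H H (comul.rTensor H x)))) := by
    intro x
    induction x with
    | zero => simp
    | add x y hx hy => simp only [tmul_add, map_add, hx, hy]
    | tmul a b =>
      simp only [map_tmul, LinearMap.rTensor_tmul, Jm_coact, B.yd, LinearMap.id_apply, ydRHS,
        LinearMap.comp_apply]
      generalize (comul (R := k) a : H ⊗[k] H) = y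
      induction y with
      | zero => simp
      | add x y hx hy => simp only [tmul_add, add_tmul, map_add, hx, hy]
      | tmul c d =>
        simp only [map_tmul, LinearEquiv.coe_coe, comm_tmul, assoc_tmul, LinearMap.id_apply,
          LinearMap.comp_apply, aa_apply]
        generalize B.coact _ = z
        induction z with
        | zero => simp
        | add x y hx hy => simp only [tmul_add, add_tmul, map_add, hx, hy]
        | tmul e f => simp [Yt]
  rw [h1, h2, Coalgebra.coassoc_apply]

theorem act_Δ (g : H) (s t : R) : actTensor B.act B.act (g ⊗ₜ (s ⊗ₜ t)) =
    TensorProduct.map (B.aa s) (B.aa t) (comul (R := k) g) := by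
  simp only [actTensor, LinearMap.comp_apply, map_tmul, LinearMap.id_apply]
  generalize (comul (R := k) g : H ⊗[k] H) = x
  induction x with
  | zero => simp
  | tmul a b => simp [aa_apply]
  | add x y hx hy => simp only [add_tmul, map_add, hx, hy]

theorem four (h : H) :
    Yt k H H (TensorProduct.map LinearMap.id (comul.rTensor H ∘ₗ comul) (comul (R := k) h)) =
    TensorProduct.map comul comul (comul (R := k) h) := by
  have h0 : ∀ x : H ⊗[k] H,
      Yt k H H (TensorProduct.map LinearMap.id (comul.rTensor H ∘ₗ comul) x) =
      TensorProduct.map LinearMap.id comul ((TensorProduct.assoc k H H H).symm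
        (comul.lTensor H x)) := by
    intro x
    induction x with
    | zero => simp
    | add x y hx hy => simp only [map_add, hx, hy]
    | tmul a b =>
      simp only [Yt, map_tmul, LinearMap.comp_apply, LinearEquiv.coe_coe, Coalgebra.coassoc_apply,
        LinearMap.lTensor_tmul, LinearMap.id_apply]
      generalize (comul (R := k) b : H ⊗[k] H) = x
      induction x with
      | zero => simp
      | tmul a b => simp
      | add x y hx hy => simp only [tmul_add, map_add, hx, hy]
  rw [h0, Coalgebra.coassoc_symm_apply]
  generalize (comul (R := k) h : H ⊗[k] H) = x
  induction x with
  | zero => simp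
  | tmul a b => simp
  | add x y hx hy => simp only [map_add, hx, hy]

theorem lhs1 (s t : R) (h : H) :
    Gm B.coact (LinearMap.mul' k H)
      (TensorProduct.map ((TensorProduct.curry (actTensor B.act B.act)).flip (s ⊗ₜ t))
        LinearMap.id (comul (R := k) h)) =
    Yt k H R (TensorProduct.map (B.aa s)
      (TensorProduct.map (B.Jm (B.coact t)) LinearMap.id ∘ₗ comul) (comul (R := k) h)) := by
  have h1 : ∀ x : H ⊗[k] H,
      TensorProduct.map ((TensorProduct.curry (actTensor B.act B.act)).flip (s ⊗ₜ t))
        LinearMap.id x =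
      TensorProduct.map (TensorProduct.map (B.aa s) (B.aa t)) LinearMap.id
        (comul.rTensor H x) := by
    intro x
    induction x with
    | zero => simp
    | add x y hx hy => simp only [map_add, hx, hy]
    | tmul a b => simp [act_Δ]
  rw [h1, ← Coalgebra.coassoc_symm_apply]
  generalize (comul (R := k) h : H ⊗[k] H) = x
  induction x with
  | zero => simp
  | add x y hx hy => simp only [map_add, hx, hy]
  | tmul a b =>
    simp only [map_tmul, LinearMap.comp_apply, LinearMap.lTensor_tmul]
    rw [← L1]
    congr 1
    generalize (comul (R := k) b : H ⊗[k] H) = x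
    induction x with
    | zero => simp
    | tmul a b => simp
    | add x y hx hy => simp only [tmul_add, map_add, hx, hy]

theorem lhs2 (s : R) (h : H) (z : H ⊗[k] R) :
    Yt k H R (TensorProduct.map (B.aa s)
      (TensorProduct.map (B.Jm z) LinearMap.id ∘ₗ comul) (comul (R := k) h)) =
    B.Um s (z ⊗ₜ comul (R := k) h) := by
  induction z with
  | zero => simp
  | add x y hx hy =>
    simp only [map_add, add_tmul, TensorProduct.map_add_left, LinearMap.add_comp,
      TensorProduct.map_add_right, LinearMap.add_apply, hx, hy]
  | tmul w t =>
    have h1 : ∀ x : H ⊗[k] H, B.Um s ((w ⊗ₜ t) ⊗ₜ x) =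
        TensorProduct.map (TensorProduct.map (B.aa s) (LinearMap.mulRight k w))
          (TensorProduct.map (B.aa t) LinearMap.id)
          (TensorProduct.map comul comul x) := by
      intro x
      induction x with
      | zero => simp
      | add x y hx hy => simp only [tmul_add, map_add, hx, hy]
      | tmul a b =>
        simp [Um, phi_tmul', mulSmash_tmul, one_ml, LinearMap.rTensor]
    rw [h1, ← four]
    generalize (comul (R := k) h : H ⊗[k] H) = x
    induction x with
    | zero => simp
    | add x y hx hy => simp only [map_add, hx, hy]
    | tmul a b =>
      simp only [map_tmul, LinearMap.comp_apply, LinearMap.id_apply]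
      generalize (comul (R := k) b : H ⊗[k] H) = x
      induction x with
      | zero => simp
      | add x y hx hy => simp only [tmul_add, map_add, hx, hy]
      | tmul c d =>
        simp only [map_tmul, LinearMap.rTensor_tmul, Jm_tmul, LinearMap.id_apply]
        generalize (comul (R := k) c : H ⊗[k] H) = x
        induction x with
        | zero => simp
        | add x y hx hy => simp only [tmul_add, add_tmul, map_add, hx, hy]
        | tmul e f => simp [Yt]

theorem phi_comul (Sinv : H →ₗ[k] H)
    (hS₁ : HopfAlgebra.antipode (R := k) ∘ₗ Sinv = LinearMap.id)
    (hS₂ : Sinv ∘ₗ HopfAlgebra.antipode (R := k) = LinearMap.id) (r : R) (h : H) :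
    comulSmash B.coact B.ΔR (B.phi (r ⊗ₜ h))
      = TensorProduct.map B.phi B.phi
          (comulSmashG B.coact (thetaMap Sinv B.act B.coact ∘ₗ B.ΔR)
              (LinearMap.mul' k H ∘ₗ (TensorProduct.comm k H H).toLinearMap) (r ⊗ₜ h)) := by
  have h1 : comulSmash B.coact B.ΔR (B.phi (r ⊗ₜ h)) =
      Gm B.coact (LinearMap.mul' k H)
      (TensorProduct.map ((TensorProduct.curry (actTensor B.act B.act)).flip (B.ΔR r))
        LinearMap.id (comul (R := k) h)) := by
    rw [phi_tmul']
    generalize (comul (R := k) h : H ⊗[k] H) = x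
    induction x with
    | zero => simp
    | add x y hx hy => simp only [map_add, hx, hy]
    | tmul a b =>
      have := LinearMap.congr_fun B.Δ_lin (a ⊗ₜ r)
      simp only [LinearMap.comp_apply, map_tmul, LinearMap.id_apply] at this
      simp only [LinearMap.rTensor_tmul, map_tmul, LinearMap.flip_apply, curry_apply, ← this,
        LinearMap.id_apply, aa_apply]
      rfl
  have h2 : comulSmashG B.coact (thetaMap Sinv B.act B.coact ∘ₗ B.ΔR)
              (LinearMap.mul' k H ∘ₗ (TensorProduct.comm k H H).toLinearMap) (r ⊗ₜ h) =
      Gm B.coact (LinearMap.mul' k H ∘ₗ (TensorProduct.comm k H H).toLinearMap)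
      (thetaMap Sinv B.act B.coact (B.ΔR r) ⊗ₜ h) := rfl
  rw [h1, h2]
  generalize B.ΔR r = x
  induction x with
  | zero => simp
  | add x y hx hy =>
    simp only [map_add, add_tmul, TensorProduct.map_add_left, LinearMap.add_apply, hx, hy]
  | tmul s t => rw [lhs1, lhs2, B.rhs_eq Sinv hS₁ hS₂]

theorem phi_counit (r : R) (h : H) :
    counitSmash B.εR (B.phi (r ⊗ₜ h)) = counitSmash B.εR (r ⊗ₜ h) := by
  rw [phi_tmul']
  have h1 : ∀ x : H ⊗[k] H, counitSmash B.εR ((B.aa r).rTensor H x) =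
      B.εR r * counit (R := k) (TensorProduct.lid k H (counit.rTensor H x)) := by
    intro x
    induction x with
    | zero => simp
    | add x y hx hy => simp only [map_add, hx, hy, mul_add]
    | tmul a b =>
      have := LinearMap.congr_fun B.ε_lin (a ⊗ₜ r)
      simp only [LinearMap.comp_apply, map_tmul, LinearMap.mul'_apply] at this
      simp [counitSmash, aa_apply, this]
      ring
  rw [h1, Coalgebra.rTensor_counit_comul]
  simp [counitSmash]

end YDBialgebra

/- STATEMENT 16: Let `H` be a Hopf algebra with bijective antipode and `R` a bialgebra in
`ᴴᴴYD`, with `R^op̲` the corresponding bialgebra in the Yetter–Drinfel'd category over `H^op`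
(action `h ·op r = S⁻¹(h)·r`, multiplication `r ⊗ r' ↦ r'r`, coproduct
`Δ^op̲(r) = S⁻¹(r⁽²⁾₍₋₁₎)·r⁽¹⁾ ⊗ r⁽²⁾₍₀₎`, same coaction and counit).  Then
`φ : R^op̲ # H^op → (R # H)^op`, `φ(r#h) = (1#h)(r#1)` (product in `R#H`), is an isomorphism
of bialgebras with inverse `φ⁻¹(r#h) = S⁻¹(h₁)·r # h₂`. -/
theorem stmt_16 {k H R : Type u} [Field k] [Ring H] [HopfAlgebra k H]
    [AddCommGroup R] [Module k R] (B : YDBialgebra k H R)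
    (Sinv : H →ₗ[k] H)
    (hS₁ : HopfAlgebra.antipode (R := k) ∘ₗ Sinv = LinearMap.id)
    (hS₂ : Sinv ∘ₗ HopfAlgebra.antipode (R := k) = LinearMap.id) :
    -- abbreviations: `φ(r#h) = (1#h)(r#1)` and `ψ(r#h) = S⁻¹(h₁)·r # h₂`
    let φ : R ⊗[k] H →ₗ[k] R ⊗[k] H :=
      mulSmash B.act B.mR
        ∘ₗ TensorProduct.map (TensorProduct.mk k R H B.oneR)
            ((TensorProduct.mk k R H).flip (1 : H))
        ∘ₗ (TensorProduct.comm k R H).toLinearMap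
    let ψ : R ⊗[k] H →ₗ[k] R ⊗[k] H :=
      TensorProduct.map
          (B.act ∘ₗ TensorProduct.map Sinv LinearMap.id ∘ₗ (TensorProduct.comm k R H).toLinearMap)
          LinearMap.id
        ∘ₗ (TensorProduct.assoc k R H H).symm.toLinearMap
        ∘ₗ TensorProduct.map LinearMap.id (Coalgebra.comul : H →ₗ[k] H ⊗[k] H)
    -- `φ` intertwines the multiplication of `R^op̲ # H^op` with the opposite of that of `R#H`:
    (φ ∘ₗ mulSmashG (B.act ∘ₗ TensorProduct.map Sinv LinearMap.id)
          (B.mR ∘ₗ (TensorProduct.comm k R R).toLinearMap)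
          (LinearMap.mul' k H ∘ₗ (TensorProduct.comm k H H).toLinearMap)
      = mulSmash B.act B.mR
          ∘ₗ (TensorProduct.comm k (R ⊗[k] H) (R ⊗[k] H)).toLinearMap
          ∘ₗ TensorProduct.map φ φ) ∧
    -- `φ` preserves the unit:
    (φ (B.oneR ⊗ₜ (1 : H)) = B.oneR ⊗ₜ (1 : H)) ∧
    -- `φ` is a coalgebra map from `R^op̲ # H^op` to `(R#H)^op` (same coproduct as `R#H`):
    (comulSmash B.coact B.ΔR ∘ₗ φ
      = TensorProduct.map φ φ
          ∘ₗ comulSmashG B.coact (thetaMap Sinv B.act B.coact ∘ₗ B.ΔR)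
              (LinearMap.mul' k H ∘ₗ (TensorProduct.comm k H H).toLinearMap)) ∧
    (counitSmash B.εR ∘ₗ φ = counitSmash B.εR) ∧
    -- `φ` is bijective with inverse `ψ`:
    (φ ∘ₗ ψ = LinearMap.id) ∧ (ψ ∘ₗ φ = LinearMap.id) := by
  intro φ ψ
  have hφ : φ = B.phi := rfl
  have hψ : ψ = B.psi Sinv := rfl
  rw [hφ, hψ]
  refine ⟨?_, ?_, ?_, ?_, ?_, ?_⟩
  · apply TensorProduct.ext_fourfold'
    intro r h r' h'
    exact B.phi_mul Sinv hS₁ hS₂ r r' h h'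
  · rw [B.phi_tmul, B.mul_one_tmul, _root_.mul_one]
  · apply TensorProduct.ext'
    intro r h
    exact B.phi_comul Sinv hS₁ hS₂ r h
  · apply TensorProduct.ext'
    intro r h
    exact B.phi_counit r h
  · apply TensorProduct.ext'
    intro r h
    exact B.phi_psi Sinv hS₁ hS₂ r h
  · apply TensorProduct.ext'
    intro r h
    exact B.psi_phi Sinv hS₁ hS₂ r h
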